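/- Let A be a poset with least element ⊥ and greatest element ⊤, and let G be an even game over A. Then [⊥] ≤ G ≤ [⊤] in the intrinsic order. -/

import Mathlib

/-- Games over a poset `α`: atomic games `[a]` for `a : α`, and composite games
`⟨L|R⟩` given by nonempty families of left and right options. -/
inductive Game (α : Type) : Type 1 where
  | atom : α → Game α
  | comp : (ι κ : Type) → (ι → Game α) → (κ → Game α) → Nonempty ι → Nonempty κ → Game α

namespace Game

variable {α β : Type}

/-- `G'` is a left option of the game. -/
def IsLeftOption (G' : Game α) : Game α → Prop
  | atom _ => False
  | comp _ _ L _ _ _ => ∃ i, L i = G'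

/-- `G'` is a right option of the game. -/
def IsRightOption (G' : Game α) : Game α → Prop
  | atom _ => False
  | comp _ _ _ R _ _ => ∃ k, R k = G'

/-- `G'` is an option of `G`. -/
def IsOption (G' G : Game α) : Prop := IsLeftOption G' G ∨ IsRightOption G' G

/-- A game is composite if it is not atomic. -/
def IsComposite : Game α → Prop
  | atom _ => False
  | comp _ _ _ _ _ _ => True

/-- `G'` is a follower of `G`: `G` itself, an option of `G`, or recursively a follower
of an option of `G`. -/
def IsFollower (G' G : Game α) : Prop := Relation.ReflTransGen IsOption G' G

/-- The dual game: Left and Right switch sides; it is a game over the opposite poset. -/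
def dual : Game α → Game αᵒᵈ
  | atom a => atom (OrderDual.toDual a)
  | comp ι κ L R hι hκ => comp κ ι (fun k => (R k).dual) (fun i => (L i).dual) hκ hι

/-- The image of a game under a (monotone) function applied to atoms. -/
def map (f : α → β) : Game α → Game β
  | atom a => atom (f a)
  | comp ι κ L R hι hκ => comp ι κ (fun i => (L i).map f) (fun k => (R k).map f) hι hκ

/-- The (disjunctive) sum of a game over `α` and a game over `β`, a game over `α × β`. -/
noncomputable def add : Game α → Game β → Game (α × β) := by
  intro G
  induction G with
  | atom g =>
    intro H
    induction H with
    | atom h => exact atom (g, h)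
    | comp ι κ L R hι hκ IHL IHR => exact comp ι κ IHL IHR hι hκ
  | comp ι κ L R hι hκ IHL IHR =>
    intro H
    induction H with
    | atom h => exact comp ι κ (fun i => IHL i (atom h)) (fun k => IHR k (atom h)) hι hκ
    | comp ι' κ' L' R' hι' hκ' IHL' IHR' =>
      exact comp (ι ⊕ ι') (κ ⊕ κ')
        (Sum.elim (fun i => IHL i (comp ι' κ' L' R' hι' hκ')) IHL')
        (Sum.elim (fun k => IHR k (comp ι' κ' L' R' hι' hκ')) IHR')
        (hι.elim fun i => ⟨Sum.inl i⟩) (hκ.elim fun k => ⟨Sum.inl k⟩)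

mutual
/-- Left has a first player winning strategy in a game over the boolean poset:
either the game is the atom `⊤`, or some left option has a second player
winning strategy for Left. -/
inductive LeftWinsFirst : Game Bool → Prop where
  | atom_top : LeftWinsFirst (atom true)
  | move {G G' : Game Bool} : IsLeftOption G' G → LeftWinsSecond G' → LeftWinsFirst G

/-- Left has a second player winning strategy in a game over the boolean poset:
every right option has a first player winning strategy for Left, and if the game
is atomic it is the atom `⊤`. -/
inductive LeftWinsSecond : Game Bool → Prop where
  | mk {G : Game Bool} : (∀ G', IsRightOption G' G → LeftWinsFirst G') →
      (∀ b, G = atom b → b = true) → LeftWinsSecond G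
end

mutual
/-- A game is even if all of its options are odd (atomic games are even). -/
inductive Even {α : Type} : Game α → Prop where
  | mk {G : Game α} : (∀ G', IsOption G' G → Odd G') → Even G

/-- A game is odd if it is composite and all of its options are even. -/
inductive Odd {α : Type} : Game α → Prop where
  | mk {G : Game α} : G.IsComposite → (∀ G', IsOption G' G → Even G') → Odd G
end

/-- A game has parity if it is even or odd. -/
def HasParity (G : Game α) : Prop := Even G ∨ Odd G

/-- `G` and `H` have matching parity (both even or both odd). -/
def MatchingParity (G H : Game α) : Prop := (Even G ∧ Even H) ∨ (Odd G ∧ Odd H)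

/-- `G` and `H` have mismatching parity (one even, the other odd). -/
def MismatchParity (G H : Game α) : Prop := (Even G ∧ Odd H) ∨ (Odd G ∧ Even H)

mutual
/-- The intrinsic order `G ≤ H` on games over a poset: every left option `G^L` of `G`
satisfies `G^L ◁ H`, every right option `H^R` of `H` satisfies `G ◁ H^R`, and if
both games are atoms `[g]`, `[h]` then `g ≤ h`. -/
inductive Le {α : Type} [PartialOrder α] : Game α → Game α → Prop where
  | mk {G H : Game α} :
      (∀ G', IsLeftOption G' G → Tri G' H) →
      (∀ H', IsRightOption H' H → Tri G H') →
      (∀ g h, G = atom g → H = atom h → g ≤ h) →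
      Le G H

/-- The intrinsic relation `G ◁ H` on games over a poset: some right option `G^R` of `G`
satisfies `G^R ≤ H`, or some left option `H^L` of `H` satisfies `G ≤ H^L`. -/
inductive Tri {α : Type} [PartialOrder α] : Game α → Game α → Prop where
  | inr {G H G' : Game α} : IsRightOption G' G → Le G' H → Tri G H
  | inl {G H H' : Game α} : IsLeftOption H' H → Le G H' → Tri G H
end

/-- The comparison game `λ(Gᵒᵖ + H)`, a game over the boolean poset, where
`λ : αᵒᵈ × α → 𝔹` is the monotone map with `λ(xᵒᵖ, y) = ⊤` iff `x ≤ y`. -/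
noncomputable def comparison [PartialOrder α] (G H : Game α) : Game Bool :=
  map (fun p : αᵒᵈ × α => @decide (OrderDual.ofDual p.1 ≤ p.2) (Classical.propDecidable _))
    (G.dual.add H)

/-- A game is locally premotive if Left has a first player winning strategy in
the comparison game `λ(Gᵒᵖ + G)`. -/
def LocallyPremotive [PartialOrder α] (G : Game α) : Prop := LeftWinsFirst (comparison G G)

/-- A game is premotive if it and all of its followers are locally premotive. -/
def Premotive [PartialOrder α] (G : Game α) : Prop :=
  ∀ G', IsFollower G' G → LocallyPremotive G'

/-- The game `* = ⟨0|0⟩` over the one-element poset. -/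
def star : Game Unit := comp Unit Unit (fun _ => atom ()) (fun _ => atom ()) ⟨()⟩ ⟨()⟩

/-- `G + *`, identified with a game over `α` via the isomorphism `α × 1 ≅ α`. -/
noncomputable def addStar (G : Game α) : Game α := map Prod.fst (G.add star)

/-- A game is locally `*`-antimonotone if `G^L + * ≤ G ≤ G^R + *` for all left and
right options `G^L`, `G^R`. -/
def LocallyStarAnti [PartialOrder α] (G : Game α) : Prop :=
  (∀ G', IsLeftOption G' G → Le G'.addStar G) ∧ (∀ G', IsRightOption G' G → Le G G'.addStar)

/-- A game is `*`-antimonotone if it and all of its followers are locally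
`*`-antimonotone. -/
def StarAnti [PartialOrder α] (G : Game α) : Prop :=
  ∀ G', IsFollower G' G → LocallyStarAnti G'

/-- `ε(G + X)`: the game `G` over `α` embedded in a context `X`, a game over the poset
`[α, 𝔹]` of monotone functions `α → 𝔹`, via the application map `ε(a, f) = f a`. -/
noncomputable def ctxSum [PartialOrder α] (G : Game α) (X : Game (α →o Bool)) : Game Bool :=
  map (fun p : α × (α →o Bool) => p.2 p.1) (G.add X)

/-- The outcome `(o_L(G), o_R(G)) ∈ 𝔹 × 𝔹` of a game over the boolean poset:
`o_L(G) = ⊤` iff Left has a first player winning strategy and `o_R(G) = ⊤` iff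
Left has a second player winning strategy. -/
noncomputable def outcome (G : Game Bool) : Bool × Bool :=
  (@decide (LeftWinsFirst G) (Classical.propDecidable _),
   @decide (LeftWinsSecond G) (Classical.propDecidable _))

/-- The contextual order `G ≤_c H`: `o(G+X) ≤ o(H+X)` for every context `X`. -/
def ContextualLe [PartialOrder α] (G H : Game α) : Prop :=
  ∀ X : Game (α →o Bool), outcome (ctxSum G X) ≤ outcome (ctxSum H X)

/-- The contextual relation `G ◁_c H`: `o_R(G+X) ≤ o_L(H+X)` for every context `X`. -/
def ContextualTri [PartialOrder α] (G H : Game α) : Prop :=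
  ∀ X : Game (α →o Bool), (outcome (ctxSum G X)).2 ≤ (outcome (ctxSum H X)).1

/-- Two games are identical when they are equal as set-based games: both are the same
atom, or both are composite with identical sets of left options and identical sets of
right options (recursively). -/
def Identical : Game α → Game α → Prop
  | atom a, atom b => a = b
  | comp _ _ L R _ _, comp _ _ L' R' _ _ =>
      ((∀ i, ∃ i', Identical (L i) (L' i')) ∧ (∀ i', ∃ i, Identical (L i) (L' i'))) ∧
      ((∀ k, ∃ k', Identical (R k) (R' k')) ∧ (∀ k', ∃ k, Identical (R k) (R' k')))
  | _, _ => False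

theorem bot_top_aux {α : Type} [PartialOrder α] [OrderBot α] [OrderTop α] (G : Game α) :
    (Even G → Le (atom ⊥) G ∧ Le G (atom ⊤)) ∧
    (Odd G → Tri (atom ⊥) G ∧ Tri G (atom ⊤)) := by
  induction G with
  | atom a =>
    refine ⟨fun _ => ⟨?_, ?_⟩, fun h => ?_⟩
    · refine Le.mk (fun _ h => h.elim) (fun _ h => h.elim) ?_
      intro g h hg _
      cases hg
      exact bot_le
    · refine Le.mk (fun _ h => h.elim) (fun _ h => h.elim) ?_
      intro g h _ hh
      cases hh
      exact le_top
    · cases h with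
      | mk hc _ => exact hc.elim
  | comp ι κ L R hι hκ IHL IHR =>
    refine ⟨fun h => ?_, fun h => ?_⟩
    · cases h with
      | mk h =>
        refine ⟨Le.mk (fun _ h => h.elim) ?_ ?_, Le.mk ?_ (fun _ h => h.elim) ?_⟩
        · rintro _ ⟨k, rfl⟩
          exact ((IHR k).2 (h _ (Or.inr ⟨k, rfl⟩))).1
        · intro g h _ hh
          cases hh
        · rintro _ ⟨i, rfl⟩
          exact ((IHL i).2 (h _ (Or.inl ⟨i, rfl⟩))).2
        · intro g h hg _
          cases hg
    · cases h with
      | mk _ h =>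
        obtain ⟨i⟩ := id hι
        obtain ⟨k⟩ := id hκ
        exact ⟨Tri.inl (H' := L i) ⟨i, rfl⟩ ((IHL i).1 (h _ (Or.inl ⟨i, rfl⟩))).1,
          Tri.inr (G' := R k) ⟨k, rfl⟩ ((IHR k).1 (h _ (Or.inr ⟨k, rfl⟩))).2⟩

/-- For an even game `G` over a poset with least element `⊥` and
greatest element `⊤`, we have `[⊥] ≤ G ≤ [⊤]`. -/
theorem bot_le_even_le_top {α : Type} [PartialOrder α] [OrderBot α] [OrderTop α]
    (G : Game α) (hG : Even G) :
    Le (atom ⊥) G ∧ Le G (atom ⊤) :=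
  (bot_top_aux G).1 hG

end Game
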